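/- Let ℓ ≥ 1, d = 2^ℓ, Δ > 0, L ≥ 2 an even integer and ε ∈ (0, 2^{−(ℓ+1)}]. For j,k ∈ {0,…,d−1} and b,b′ ∈ {0,1} define the real number M_{(j,b),(k,b′)} = δ_{b,b′}·((1−b)·δ_{j,k} + b·∫_ℝ Sha^ε_{L,Δ}(j)_d(x)·Sha^ε_{L,Δ}(k)_d(x − √(2π/d)) dx); this is the matrix element of the qubit-controlled translation W = I⊗|0⟩⟨0| + (translation by √(2π/d))⊗|1⟩⟨1| with respect to the basis Sha^ε_{L,Δ}(j)_d ⊗ |b⟩. Then for all j,k ∈ {0,…,d−1} and b,b′ ∈ {0,1}: (1 − 2/L)·δ_{b,b′}·δ_{j, k⊕b} ≤ M_{(j,b),(k,b′)} ≤ δ_{b,b′}·δ_{j, k⊕b}, where ⊕ denotes addition modulo d. In particular, the matrix M is 1-sparse. -/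

import Mathlib

open MeasureTheory Real

/-- The unnormalized truncated Gaussian: `e^{−x²/(2Δ²)}` for `|x| ≤ ε` and `0` otherwise. -/
noncomputable def truncGauss (Δ ε : ℝ) (x : ℝ) : ℝ :=
  if |x| ≤ ε then Real.exp (-x ^ 2 / (2 * Δ ^ 2)) else 0

/-- The normalized truncated Gaussian `Ψ^ε_Δ`, with unit `L²(ℝ)`-norm. -/
noncomputable def truncGaussNorm (Δ ε : ℝ) (x : ℝ) : ℝ :=
  truncGauss Δ ε x / Real.sqrt (∫ y : ℝ, truncGauss Δ ε y ^ 2)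

/-- The rectangular-envelope GKP (comb) state
`Sha^ε_{L,Δ} = L^{−1/2}·Σ_{z=−L/2}^{L/2−1} Ψ^ε_Δ(· − z)`. -/
noncomputable def shaState (L : ℕ) (Δ ε : ℝ) (x : ℝ) : ℝ :=
  (Real.sqrt L)⁻¹ *
    ∑ z ∈ Finset.Icc (-(L : ℤ) / 2) ((L : ℤ) / 2 - 1), truncGaussNorm Δ ε (x - z)

/-- The rectangular-envelope GKP code state
`Sha^ε_{L,Δ}(j)_d(x) = (2πd)^{−1/4}·Sha^ε_{L,Δ}((x − √(2π/d)·j)/√(2πd))`. -/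
noncomputable def shaCode (d L : ℕ) (Δ ε : ℝ) (j : ℕ) (x : ℝ) : ℝ :=
  (2 * π * d) ^ (-(1 / 4 : ℝ)) *
    shaState L Δ ε ((x - Real.sqrt (2 * π / d) * j) / Real.sqrt (2 * π * d))

/-- Matrix element
`M_{(j,b),(k,b′)} = δ_{b,b′}·((1−b)·δ_{j,k} + b·∫ Sha^ε_{L,Δ}(j)_d(x)·Sha^ε_{L,Δ}(k)_d(x − √(2π/d)) dx)`
of the qubit-controlled translation `W = I⊗|0⟩⟨0| + (translation by √(2π/d))⊗|1⟩⟨1|` in the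
basis `Sha^ε_{L,Δ}(j)_d ⊗ |b⟩`. -/
noncomputable def ctrlShiftMatSha (d L : ℕ) (Δ ε : ℝ) (p q : Fin d × Fin 2) : ℝ :=
  (if p.2 = q.2 then 1 else 0) *
    (((1 - (p.2 : ℕ) : ℕ) : ℝ) * (if p.1 = q.1 then 1 else 0) +
      ((p.2 : ℕ) : ℝ) *
        ∫ x : ℝ, shaCode d L Δ ε (p.1 : ℕ) x *
          shaCode d L Δ ε (q.1 : ℕ) (x - Real.sqrt (2 * π / d)))

lemma truncGauss_sq_eq_indicator (Δ ε : ℝ) :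
    (fun y ↦ truncGauss Δ ε y ^ 2) =
      (Set.Icc (-ε) ε).indicator fun y ↦ Real.exp (-y ^ 2 / (2 * Δ ^ 2)) ^ 2 := by
  ext y
  simp only [truncGauss, Set.indicator, Set.mem_Icc, abs_le]
  split_ifs <;> simp

lemma integrable_truncGauss_sq (Δ ε : ℝ) : Integrable fun y ↦ truncGauss Δ ε y ^ 2 := by
  rw [truncGauss_sq_eq_indicator, integrable_indicator_iff measurableSet_Icc]
  exact Continuous.integrableOn_Icc (by fun_prop)

lemma integral_truncGauss_sq_pos (Δ : ℝ) {ε : ℝ} (hε : 0 < ε) :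
    0 < ∫ y, truncGauss Δ ε y ^ 2 := by
  rw [integral_pos_iff_support_of_nonneg (fun y ↦ sq_nonneg _) (integrable_truncGauss_sq Δ ε)]
  refine lt_of_lt_of_le ?_ (measure_mono (s := Set.Icc (-ε) ε) ?_)
  · simp [hε]
  · intro y hy
    simp [truncGauss, abs_le.2 hy]

lemma truncGaussNorm_mul_self (Δ ε x : ℝ) :
    truncGaussNorm Δ ε x * truncGaussNorm Δ ε x =
      truncGauss Δ ε x ^ 2 / ∫ y, truncGauss Δ ε y ^ 2 := by
  rw [truncGaussNorm, div_mul_div_comm, Real.mul_self_sqrt (integral_nonneg fun _ ↦ sq_nonneg _),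
    sq]

lemma integrable_truncGaussNorm_mul_self (Δ ε a : ℝ) :
    Integrable fun y ↦ truncGaussNorm Δ ε (y - a) * truncGaussNorm Δ ε (y - a) := by
  simp only [truncGaussNorm_mul_self]
  exact ((integrable_truncGauss_sq Δ ε).comp_sub_right a).div_const _

lemma integral_truncGaussNorm_mul_self (Δ : ℝ) {ε : ℝ} (hε : 0 < ε) (a : ℝ) :
    ∫ y, truncGaussNorm Δ ε (y - a) * truncGaussNorm Δ ε (y - a) = 1 := by
  simp only [truncGaussNorm_mul_self]
  rw [integral_sub_right_eq_self (fun y ↦ truncGauss Δ ε y ^ 2 / ∫ y, truncGauss Δ ε y ^ 2) a,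
    integral_div, div_self (integral_truncGauss_sq_pos Δ hε).ne']

lemma truncGaussNorm_mul_ae_eq_zero (Δ : ℝ) {ε a b : ℝ} (h : 2 * ε ≤ |a - b|) :
    (fun y ↦ truncGaussNorm Δ ε (y - a) * truncGaussNorm Δ ε (y - b)) =ᵐ[volume] 0 := by
  have hne : ∀ᵐ y : ℝ, y ≠ (a + b) / 2 := Measure.ae_ne volume _
  filter_upwards [hne] with y hy
  by_contra hprod
  obtain ⟨ha, hb⟩ := mul_ne_zero_iff.1 hprod
  have haε : |y - a| ≤ ε := by
    by_contra hc
    simp [truncGaussNorm, truncGauss, hc] at ha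
  have hbε : |y - b| ≤ ε := by
    by_contra hc
    simp [truncGaussNorm, truncGauss, hc] at hb
  rw [abs_le] at haε hbε
  refine hy ?_
  rcases le_abs.1 h with h | h <;> linarith

lemma integrable_and_integral_truncGaussNorm_mul (Δ : ℝ) {ε : ℝ} (hε : 0 < ε) {d : ℕ} (hd : 0 < d)
    (hdε : 2 * ε ≤ 1 / d) (m n : ℤ) :
    Integrable (fun y ↦ truncGaussNorm Δ ε (y - m / d) * truncGaussNorm Δ ε (y - n / d)) ∧
    ∫ y, truncGaussNorm Δ ε (y - m / d) * truncGaussNorm Δ ε (y - n / d) =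
      if m = n then 1 else 0 := by
  split_ifs with hmn
  · subst hmn
    exact ⟨integrable_truncGaussNorm_mul_self Δ ε _, integral_truncGaussNorm_mul_self Δ hε _⟩
  · have hd' : (0 : ℝ) < d := by exact_mod_cast hd
    have hsep : 2 * ε ≤ |(m : ℝ) / d - n / d| := by
      rw [← sub_div, abs_div, abs_of_pos hd']
      refine hdε.trans ?_
      gcongr
      exact_mod_cast Int.one_le_abs (sub_ne_zero.2 hmn)
    have hae := truncGaussNorm_mul_ae_eq_zero Δ hsep
    exact ⟨(integrable_zero ℝ ℝ volume).congr hae.symm, by simp [integral_congr_ae hae]⟩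

lemma integral_shaState_mul (L : ℕ) (Δ : ℝ) {ε : ℝ} (hε : 0 < ε) {d : ℕ} (hd : 0 < d)
    (hdε : 2 * ε ≤ 1 / d) (j k : ℤ) :
    ∫ y, shaState L Δ ε (y - j / d) * shaState L Δ ε (y - k / d) =
      (L : ℝ)⁻¹ * ∑ z ∈ Finset.Icc (-(L : ℤ) / 2) ((L : ℤ) / 2 - 1),
        ∑ w ∈ Finset.Icc (-(L : ℤ) / 2) ((L : ℤ) / 2 - 1),
          if j + d * z = k + d * w then (1 : ℝ) else 0 := by
  have hd' : (d : ℝ) ≠ 0 := by exact_mod_cast hd.ne'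
  have hshift (y : ℝ) (i z : ℤ) : y - i / d - z = y - ((i + d * z : ℤ) : ℝ) / d := by
    push_cast
    field_simp
    ring
  have hint := integrable_and_integral_truncGaussNorm_mul Δ hε hd hdε
  have hL : (Real.sqrt L)⁻¹ * (Real.sqrt L)⁻¹ = (L : ℝ)⁻¹ := by
    rw [← mul_inv, Real.mul_self_sqrt (Nat.cast_nonneg L)]
  simp only [shaState, mul_mul_mul_comm, hL, Finset.sum_mul_sum, hshift]
  rw [integral_const_mul, integral_finsetSum _
    fun z _ ↦ integrable_finsetSum _ fun w _ ↦ (hint _ _).1]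
  congr 1
  refine Finset.sum_congr rfl fun z _ ↦ ?_
  rw [integral_finsetSum _ fun w _ ↦ (hint _ _).1]
  exact Finset.sum_congr rfl fun w _ ↦ (hint _ _).2

lemma integral_shaCode_mul {d : ℕ} (hd : 0 < d) (L : ℕ) (Δ ε : ℝ) (j k : ℕ) :
    ∫ x, shaCode d L Δ ε j x * shaCode d L Δ ε k (x - Real.sqrt (2 * π / d)) =
      ∫ y, shaState L Δ ε (y - (j : ℤ) / d) * shaState L Δ ε (y - ((k + 1 : ℤ) : ℝ) / d) := by
  have hd' : (0 : ℝ) < d := by exact_mod_cast hd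
  have hs : (0 : ℝ) < 2 * π * d := by positivity
  have hr : 0 < Real.sqrt (2 * π * d) := Real.sqrt_pos.2 hs
  have hratio : Real.sqrt (2 * π / d) = Real.sqrt (2 * π * d) / d := by
    rw [show 2 * π / d = 2 * π * d / (d : ℝ) ^ 2 by field_simp, Real.sqrt_div hs.le,
      Real.sqrt_sq hd'.le]
  have hconst : (2 * π * d) ^ (-(1 / 4 : ℝ)) * (2 * π * d) ^ (-(1 / 4 : ℝ)) =
      (Real.sqrt (2 * π * d))⁻¹ := by
    rw [← Real.rpow_add hs, Real.sqrt_eq_rpow, ← Real.rpow_neg hs.le]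
    norm_num
  have harg₁ (x : ℝ) : (x - Real.sqrt (2 * π / d) * j) / Real.sqrt (2 * π * d) =
      x / Real.sqrt (2 * π * d) - (j : ℤ) / d := by
    rw [hratio, Int.cast_natCast]
    field_simp
  have harg₂ (x : ℝ) : (x - Real.sqrt (2 * π / d) - Real.sqrt (2 * π / d) * k) /
      Real.sqrt (2 * π * d) = x / Real.sqrt (2 * π * d) - ((k + 1 : ℤ) : ℝ) / d := by
    rw [hratio]
    push_cast
    field_simp
    ring
  simp only [shaCode, harg₁, harg₂, mul_mul_mul_comm _ (shaState _ _ _ _), hconst]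
  rw [integral_const_mul, Measure.integral_comp_div
    (fun y ↦ shaState L Δ ε (y - (j : ℤ) / d) * shaState L Δ ε (y - ((k + 1 : ℤ) : ℝ) / d)),
    abs_of_pos hr, smul_eq_mul, inv_mul_cancel_left₀ hr.ne']

lemma sum_sum_Icc_ite_bounds {L : ℕ} (hL : Even L) {d : ℕ} {j k : ℕ} (hj : j < d)
    (hk : k < d) :
    ((L : ℝ) - 2) * (if j = (k + 1) % d then 1 else 0) ≤
      ∑ z ∈ Finset.Icc (-(L : ℤ) / 2) ((L : ℤ) / 2 - 1),
        ∑ w ∈ Finset.Icc (-(L : ℤ) / 2) ((L : ℤ) / 2 - 1),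
          (if (j : ℤ) + d * z = (k + 1 : ℤ) + d * w then (1 : ℝ) else 0) ∧
    ∑ z ∈ Finset.Icc (-(L : ℤ) / 2) ((L : ℤ) / 2 - 1),
        ∑ w ∈ Finset.Icc (-(L : ℤ) / 2) ((L : ℤ) / 2 - 1),
          (if (j : ℤ) + d * z = (k + 1 : ℤ) + d * w then (1 : ℝ) else 0) ≤
      L * (if j = (k + 1) % d then 1 else 0) := by
  obtain ⟨m, rfl⟩ := hL
  have h₁ : -((m + m : ℕ) : ℤ) / 2 = -m := by omega
  have h₂ : ((m + m : ℕ) : ℤ) / 2 - 1 = m - 1 := by omega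
  rw [h₁, h₂]
  split_ifs with hjk
  · obtain ⟨c, hc, hc'⟩ : ∃ c : ℤ, (c = 0 ∨ c = 1) ∧ (k + 1 : ℤ) = j + d * c := by
      rcases (Nat.succ_le_of_lt hk).lt_or_eq with h | h
      · rw [Nat.mod_eq_of_lt h] at hjk
        exact ⟨0, Or.inl rfl, by simp [hjk]⟩
      · rw [← Nat.succ_eq_add_one, h, Nat.mod_self] at hjk
        exact ⟨1, Or.inr rfl, by rw [hjk, ← h]; push_cast; ring⟩
    have hiff (z w : ℤ) : (j : ℤ) + d * z = (k + 1 : ℤ) + d * w ↔ z - c = w := by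
      have hd : (d : ℤ) ≠ 0 := by omega
      rw [hc', ← mul_right_inj' hd (b := z - c)]
      constructor <;> intro h <;> linarith
    simp only [hiff, Finset.sum_ite_eq, Finset.sum_boole, mul_one]
    constructor
    · have hsub : Finset.Icc (-(m : ℤ) + 1) (m - 1) ⊆
          (Finset.Icc (-(m : ℤ)) (m - 1)).filter fun z ↦ z - c ∈ Finset.Icc (-(m : ℤ)) (m - 1) := by
        intro z
        simp only [Finset.mem_filter, Finset.mem_Icc]
        omega
      have hcard := Finset.card_le_card hsub
      rw [Int.card_Icc] at hcard
      generalize Finset.card (α := ℤ) _ = n at hcard ⊢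
      rw [sub_le_iff_le_add]
      norm_cast
      omega
    · have hcard := Finset.card_filter_le (Finset.Icc (-(m : ℤ)) (m - 1))
        fun z ↦ z - c ∈ Finset.Icc (-(m : ℤ)) (m - 1)
      rw [Int.card_Icc] at hcard
      generalize Finset.card (α := ℤ) _ = n at hcard ⊢
      norm_cast
      omega
  · have hne (z w : ℤ) : ¬ (j : ℤ) + d * z = (k + 1 : ℤ) + d * w := by
      intro h
      apply hjk
      have hmod : (j : ℤ) % d = ((k : ℤ) + 1) % d := by
        rw [← Int.add_mul_emod_self_left (j : ℤ) d z, h, Int.add_mul_emod_self_left]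
      rw [← Nat.mod_eq_of_lt hj]
      exact_mod_cast hmod
    simp [hne]

lemma ctrlShiftMatSha_bounds {d : ℕ} (Δ : ℝ) {L : ℕ} (hL : 2 ≤ L) (hLeven : Even L)
    {ε : ℝ} (hε : 0 < ε) (hdε : 2 * ε ≤ 1 / d) (j k : Fin d) (b b' : Fin 2) :
    (1 - 2 / (L : ℝ)) * ((if b = b' then 1 else 0) *
        (if (j : ℕ) = ((k : ℕ) + (b : ℕ)) % d then 1 else 0)) ≤
      ctrlShiftMatSha d L Δ ε (j, b) (k, b') ∧
    ctrlShiftMatSha d L Δ ε (j, b) (k, b') ≤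
      (if b = b' then 1 else 0) *
        (if (j : ℕ) = ((k : ℕ) + (b : ℕ)) % d then 1 else 0) := by
  have hd : 0 < d := j.pos
  have hL' : (0 : ℝ) < L := by exact_mod_cast (by omega : 0 < L)
  unfold ctrlShiftMatSha
  by_cases hb : b = b'
  · subst hb
    fin_cases b
    · have : 0 ≤ 2 / (L : ℝ) := by positivity
      simp only [Fin.ext_iff, Fin.zero_eta, add_zero, Nat.mod_eq_of_lt k.2]
      split_ifs <;> simp [this]
    · obtain ⟨hlo, hhi⟩ := sum_sum_Icc_ite_bounds hLeven j.2 k.2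
      rw [show (1 : ℝ) - 2 / L = (L : ℝ)⁻¹ * (L - 2) by field_simp]
      simp only [integral_shaCode_mul hd, integral_shaState_mul L Δ hε hd hdε, Fin.mk_one,
        if_true, one_mul, Nat.cast_one, tsub_self, Nat.cast_zero, zero_mul, zero_add,
        mul_assoc]
      exact ⟨by gcongr, by rwa [inv_mul_le_iff₀ hL']⟩
  · simp [hb]

/-- Two-sided bound for the matrix elements of the qubit-controlled translation in the
rectangular-envelope GKP code (`d = 2^ℓ`), and 1-sparsity of the resulting matrix.
Here `⊕` is addition modulo `d`, i.e. `j = (k + b) mod d`. -/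
theorem sha_ctrlShift_matrix_bounds (ℓ : ℕ) (hℓ : 1 ≤ ℓ) (Δ : ℝ) (hΔ : 0 < Δ)
    (L : ℕ) (hL : 2 ≤ L) (hLeven : Even L)
    (ε : ℝ) (hε : 0 < ε) (hε' : ε ≤ 1 / 2 ^ (ℓ + 1)) :
    (∀ (j k : Fin (2 ^ ℓ)) (b b' : Fin 2),
      (1 - 2 / (L : ℝ)) * ((if b = b' then 1 else 0) *
          (if (j : ℕ) = ((k : ℕ) + (b : ℕ)) % 2 ^ ℓ then 1 else 0)) ≤
        ctrlShiftMatSha (2 ^ ℓ) L Δ ε (j, b) (k, b') ∧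
      ctrlShiftMatSha (2 ^ ℓ) L Δ ε (j, b) (k, b') ≤
        (if b = b' then 1 else 0) *
          (if (j : ℕ) = ((k : ℕ) + (b : ℕ)) % 2 ^ ℓ then 1 else 0)) ∧
    (∀ p : Fin (2 ^ ℓ) × Fin 2,
      {q : Fin (2 ^ ℓ) × Fin 2 | ctrlShiftMatSha (2 ^ ℓ) L Δ ε p q ≠ 0}.ncard ≤ 1) ∧
    (∀ q : Fin (2 ^ ℓ) × Fin 2,
      {p : Fin (2 ^ ℓ) × Fin 2 | ctrlShiftMatSha (2 ^ ℓ) L Δ ε p q ≠ 0}.ncard ≤ 1) := by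
  have hdε : 2 * ε ≤ 1 / ((2 ^ ℓ : ℕ) : ℝ) := by
    push_cast
    calc 2 * ε ≤ 2 * (1 / 2 ^ (ℓ + 1)) := by gcongr
      _ = 1 / 2 ^ ℓ := by rw [pow_succ]; field_simp
  have hbounds := ctrlShiftMatSha_bounds (d := 2 ^ ℓ) Δ hL hLeven hε hdε
  have hsupp (p q : Fin (2 ^ ℓ) × Fin 2) (h : ctrlShiftMatSha (2 ^ ℓ) L Δ ε p q ≠ 0) :
      p.2 = q.2 ∧ (p.1 : ℕ) = ((q.1 : ℕ) + (p.2 : ℕ)) % 2 ^ ℓ := by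
    obtain ⟨hlo, hhi⟩ := hbounds p.1 q.1 p.2 q.2
    by_contra hc
    rw [not_and_or] at hc
    refine h (le_antisymm ?_ ?_) <;> rcases hc with hc | hc <;> simp_all
  refine ⟨hbounds, fun p ↦ ?_, fun q ↦ ?_⟩
  · rw [Set.ncard_le_one]
    intro q hq q' hq'
    obtain ⟨hb, hj⟩ := hsupp p q hq
    obtain ⟨hb', hj'⟩ := hsupp p q' hq'
    refine Prod.ext (Fin.ext ?_) (hb.symm.trans hb')
    have hmod : (q.1 : ℕ) ≡ q'.1 [MOD 2 ^ ℓ] := Nat.ModEq.add_right_cancel' _ (hj.symm.trans hj')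
    exact hmod.eq_of_lt_of_lt q.1.2 q'.1.2
  · rw [Set.ncard_le_one]
    intro p hp p' hp'
    obtain ⟨hb, hj⟩ := hsupp p q hp
    obtain ⟨hb', hj'⟩ := hsupp p' q hp'
    have hpp : p.2 = p'.2 := hb.trans hb'.symm
    exact Prod.ext (Fin.ext (by rw [hj, hj', hpp])) hpp
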